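/- Let 0 ≤ f_{L,i} < f_{H,i} < 1 for i = 1,...,d and let g_i be the trigonometric polynomial with coefficients r_{0,i} = -2cos(π(f_{H,i} - f_{L,i})) and r_{1,i} = e^{iπ(f_{L,i} + f_{H,i})}. Let B : ℤ^d → ℂ be such that the d-level block Toeplitz matrix T(B) is positive semidefinite with r = rank(T(B)) < min_i N_i, and suppose T_{g_i}(B) is positive semidefinite for every i = 1,...,d. Then there exist pairwise distinct points f_1,...,f_r with f_{i,ℓ} ∈ [f_{L,i}, f_{H,i}] for all i and ℓ, and positive reals σ_1,...,σ_r, such that T(B) = ∑_{ℓ=1}^{r} σ_ℓ a(f_ℓ) a(f_ℓ)ᴴ (the frequency-selective MD Vandermonde decomposition). -/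

import Mathlib

open Complex Matrix BigOperators
open scoped ComplexOrder

/-- The multi-dimensional sinusoid `a(f)`, `a(f)(m) = ∏ i, exp(2πi m_i f_i)`. -/
noncomputable def sinusoid {d : ℕ} (N : Fin d → ℕ) (f : Fin d → ℝ) :
    (∀ i, Fin (N i)) → ℂ :=
  fun m => ∏ i, Complex.exp (2 * (Real.pi : ℂ) * Complex.I * ((m i : ℕ) : ℂ) * ((f i : ℝ) : ℂ))

/-- The `d`-level block Toeplitz matrix `T(B)(m,n) = B(m-n)`. -/
noncomputable def toepT {d : ℕ} (N : Fin d → ℕ) (B : (Fin d → ℤ) → ℂ) :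
    Matrix (∀ i, Fin (N i)) (∀ i, Fin (N i)) ℂ :=
  Matrix.of fun m n => B (fun i => (m i : ℤ) - (n i : ℤ))

/-- The filtered matrix `T_{g_i}(B)(m,n) = ∑_{k=-1}^1 r_k B(m-n-k e_i)`,
with `r_{-1} = conj r_1`, indexed by `Ī = ∏ i {0,…,N_i-2}`. -/
noncomputable def toepTg {d : ℕ} (N : Fin d → ℕ) (i0 : Fin d) (r0 : ℝ) (r1 : ℂ)
    (B : (Fin d → ℤ) → ℂ) :
    Matrix (∀ i, Fin (N i - 1)) (∀ i, Fin (N i - 1)) ℂ :=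
  Matrix.of fun m n =>
    (starRingEnd ℂ) r1 * B (fun i => (m i : ℤ) - (n i : ℤ) + (if i = i0 then 1 else 0)) +
    (r0 : ℂ) * B (fun i => (m i : ℤ) - (n i : ℤ)) +
    r1 * B (fun i => (m i : ℤ) - (n i : ℤ) - (if i = i0 then 1 else 0))

section
variable {E : Type*} [NormedAddCommGroup E] [InnerProductSpace ℂ E]

/-- Two families of vectors with the same Gram matrix are related by a linear isometry. -/
theorem exists_linearIsometry_of_inner_eq [FiniteDimensional ℂ E] {A : Type*} (x y : A → E)
    (h : ∀ a b, inner ℂ (x a) (x b) = inner ℂ (y a) (y b)) :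
    ∃ U : E →ₗᵢ[ℂ] E, ∀ a, U (x a) = y a := by
  set X := Finsupp.linearCombination ℂ x with hX
  set Y := Finsupp.linearCombination ℂ y with hY
  have hn : ∀ c, ‖X c‖ = ‖Y c‖ := by
    intro c
    have : inner ℂ (X c) (X c) = inner ℂ (Y c) (Y c) := by
      simp only [hX, hY, Finsupp.linearCombination_apply, Finsupp.sum, sum_inner, inner_sum,
        inner_smul_left, inner_smul_right, h]
    rw [inner_self_eq_norm_sq_to_K, inner_self_eq_norm_sq_to_K] at this
    exact (sq_eq_sq₀ (norm_nonneg _) (norm_nonneg _)).1 (by exact_mod_cast this)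
  have hk : X.ker ≤ Y.ker := fun c hc => by
    rw [LinearMap.mem_ker] at hc ⊢
    rw [← norm_eq_zero, ← hn, hc, norm_zero]
  let g : X.range →ₗ[ℂ] E := X.ker.liftQ Y hk ∘ₗ X.quotKerEquivRange.symm.toLinearMap
  have hg : ∀ c, g ⟨X c, LinearMap.mem_range_self X c⟩ = Y c := fun c => by
    have : X.quotKerEquivRange.symm ⟨X c, LinearMap.mem_range_self X c⟩ = X.ker.mkQ c := by
      rw [LinearEquiv.symm_apply_eq]; rfl
    simp only [g, LinearMap.comp_apply, LinearEquiv.coe_coe, this]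
    exact Submodule.liftQ_apply _ _ _
  let G : X.range →ₗᵢ[ℂ] E := ⟨g, by
    rintro ⟨_, c, rfl⟩
    rw [hg, ← hn]; rfl⟩
  refine ⟨G.extend, fun a => ?_⟩
  have h1 := hg (Finsupp.single a 1)
  have h2 := G.extend_apply ⟨X (Finsupp.single a 1), LinearMap.mem_range_self X _⟩
  change _ = g _ at h2
  rw [h1] at h2
  simpa [hX, hY] using h2

/-- A linear isometry of a finite-dimensional space is semisimple. -/
theorem LinearIsometry.isSemisimple [FiniteDimensional ℂ E] (U : E →ₗᵢ[ℂ] E) :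
    Module.End.IsSemisimple (U.toLinearMap : Module.End ℂ E) := by
  rw [Module.End.isSemisimple_iff]
  intro p hp
  refine ⟨pᗮ, ?_, p.isCompl_orthogonal⟩
  rw [Module.End.mem_invtSubmodule_iff_map_le] at hp
  have hpe : p.map U.toLinearMap = p := Submodule.eq_of_le_of_finrank_eq hp
    (Submodule.equivMapOfInjective U.toLinearMap U.injective p).finrank_eq.symm
  intro y hy
  rw [Submodule.mem_comap, Submodule.mem_orthogonal]
  intro x hx
  rw [← hpe] at hx
  obtain ⟨z, hz, rfl⟩ := hx
  exact (U.inner_map_map z y).trans ((Submodule.mem_orthogonal _ _).1 hy z hz)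

theorem LinearIsometry.norm_eq_one_of_apply_eq_smul {U : E →ₗᵢ[ℂ] E} {x : E} {μ : ℂ}
    (hx : x ≠ 0) (h : U x = μ • x) : ‖μ‖ = 1 := by
  have := U.norm_map x
  rw [h, norm_smul] at this
  exact mul_right_cancel₀ (norm_ne_zero_iff.2 hx) (this.trans (one_mul _).symm)

/-- Eigenvectors of a linear isometry for distinct eigenvalues are orthogonal. -/
theorem LinearIsometry.inner_eq_zero_of_eigenvalue_ne (U : E →ₗᵢ[ℂ] E) {x y : E} {μ ν : ℂ}
    (hx : U x = μ • x) (hy : U y = ν • y) (hne : μ ≠ ν) : inner ℂ x y = 0 := by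
  rcases eq_or_ne x 0 with rfl | hx0
  · simp
  have h1 := LinearIsometry.norm_eq_one_of_apply_eq_smul hx0 hx
  have h2 := U.inner_map_map x y
  rw [hx, hy, inner_smul_left, inner_smul_right, ← mul_assoc] at h2
  by_contra h0
  have h3 : (starRingEnd ℂ) μ * ν = 1 := mul_right_cancel₀ h0 (h2.trans (one_mul _).symm)
  have h4 : (starRingEnd ℂ) μ * μ = 1 := by
    rw [Complex.conj_mul', h1]; simp
  have h5 : (starRingEnd ℂ) μ ≠ 0 := left_ne_zero_of_mul_eq_one h4
  exact hne (mul_left_cancel₀ h5 (h4.trans h3.symm))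

/-- Commuting linear isometries of a finite-dimensional space are simultaneously diagonal in some
orthonormal basis. -/
theorem exists_orthonormalBasis_joint_eigenvector [FiniteDimensional ℂ E] {ι : Type*}
    (U : ι → E →ₗᵢ[ℂ] E)
    (hU : ∀ i j x, U i (U j x) = U j (U i x)) {n : ℕ} (hn : Module.finrank ℂ E = n) :
    ∃ (b : OrthonormalBasis (Fin n) ℂ E) (μ : Fin n → ι → ℂ),
      ∀ l i, U i (b l) = μ l i • b l := by
  classical
  set T : ι → Module.End ℂ E := fun i => (U i).toLinearMap with hT
  set V : (ι → ℂ) → Submodule ℂ E := fun χ => ⨅ i, (T i).eigenspace (χ i) with hV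
  have hmem : ∀ χ x, x ∈ V χ ↔ ∀ i, U i x = χ i • x := fun χ x => by
    simp [hV, Submodule.mem_iInf, hT]
  have htop : ⨆ χ, V χ = ⊤ := by
    have hs : ∀ i, (T i).IsFinitelySemisimple := fun i =>
      (LinearIsometry.isSemisimple (U i)).isFinitelySemisimple
    have := Module.End.iSup_iInf_maxGenEigenspace_eq_top_of_iSup_maxGenEigenspace_eq_top_of_commute
      T (fun i j _ => LinearMap.ext fun x => hU i j x)
      (fun i => Module.End.iSup_maxGenEigenspace_eq_top _)
    simpa only [(hs _).maxGenEigenspace_eq_eigenspace] using this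
  have horth : OrthogonalFamily ℂ (fun χ => V χ) fun χ => (V χ).subtypeₗᵢ :=
    OrthogonalFamily.of_pairwise fun χ χ' hne x hx y hy => by
      obtain ⟨i, hi⟩ := Function.ne_iff.1 hne
      exact (U i).inner_eq_zero_of_eigenvalue_ne ((hmem _ _).1 hy i)
        ((hmem _ _).1 hx i) hi.symm
  have hint : DirectSum.IsInternal fun χ : {χ // V χ ≠ ⊥} => V χ := by
    rw [DirectSum.isInternal_ne_bot_iff,
      DirectSum.isInternal_submodule_iff_iSupIndep_and_iSup_eq_top]
    exact ⟨horth.independent, htop⟩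
  have : Fintype {χ // V χ ≠ ⊥} :=
    (WellFoundedGT.finite_ne_bot_of_iSupIndep horth.independent).fintype
  have horth' := horth.comp (Subtype.val_injective (p := fun χ => V χ ≠ ⊥))
  refine ⟨hint.subordinateOrthonormalBasis hn horth',
    fun l => (hint.subordinateOrthonormalBasisIndex hn l horth').1, fun l i => ?_⟩
  exact (hmem _ _).1 (hint.subordinateOrthonormalBasis_subordinate hn l horth') i

/-- High powers of an endomorphism applied to a vector lie in the span of low ones. -/
theorem pow_apply_mem_span_of_finrank_le {K M : Type*} [Field K] [AddCommGroup M] [Module K M]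
    [FiniteDimensional K M] (f : Module.End K M) (x : M) {n : ℕ} (hn : Module.finrank K M ≤ n) :
    (f ^ n) x ∈ Submodule.span K {y | ∃ j < n, y = (f ^ j) x} := by
  rcases n.eq_zero_or_pos with rfl | hpos
  · have := Module.finrank_zero_iff.1 (Nat.le_zero.1 hn)
    rw [Subsingleton.elim ((f ^ 0) x) 0]
    exact Submodule.zero_mem _
  have h1 := f.aeval_eq_aeval_mod_charpoly (Polynomial.X ^ n)
  set q : Polynomial K := Polynomial.X ^ n %ₘ f.charpoly
  rw [Polynomial.aeval_X_pow] at h1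
  rw [h1, Polynomial.aeval_eq_sum_range, LinearMap.sum_apply]
  refine Submodule.sum_mem _ fun j hj => ?_
  rcases eq_or_ne (q.coeff j) 0 with h0 | h0
  · simp [h0]
  refine Submodule.smul_mem _ _ (Submodule.subset_span ⟨j, ?_, rfl⟩)
  have h2 : q.degree < f.charpoly.degree := Polynomial.degree_modByMonic_lt _ f.charpoly_monic
  have h3 := (Polynomial.le_degree_of_ne_zero h0).trans_lt h2
  rw [Polynomial.degree_eq_natDegree f.charpoly_monic.ne_zero, f.charpoly_natDegree] at h3
  have h4 : j < Module.finrank K M := by exact_mod_cast h3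
  omega

/-- A positive semidefinite matrix is the Gram matrix of vectors spanning a space of dimension its
rank. -/
theorem Matrix.PosSemidef.exists_gram {I : Type*} [Fintype I] {T : Matrix I I ℂ}
    (hT : T.PosSemidef) :
    ∃ v : I → EuclideanSpace ℂ (Fin T.rank),
      (∀ m n, inner ℂ (v m) (v n) = T m n) ∧ Submodule.span ℂ (Set.range v) = ⊤ := by
  classical
  obtain ⟨k, C, hC⟩ : ∃ (k : ℕ) (C : Matrix (Fin k) I ℂ), T = Cᴴ * C := by
    obtain ⟨k, y, hy⟩ := Matrix.posSemidef_iff_eq_sum_vecMulVec.1 hT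
    refine ⟨k, Matrix.of fun a m => star (y a m), ?_⟩
    ext m n
    simp [hy, Matrix.sum_apply, Matrix.vecMulVec_apply, Matrix.mul_apply]
  set u : I → EuclideanSpace ℂ (Fin k) := fun m => WithLp.toLp 2 (C.col m) with hu
  have huT : ∀ m n, inner ℂ (u m) (u n) = T m n := fun m n => by
    simp [hC, hu, EuclideanSpace.inner_eq_star_dotProduct, Matrix.mul_apply, dotProduct, mul_comm]
  set S := Submodule.span ℂ (Set.range u) with hS
  have hfr : Module.finrank ℂ S = T.rank := by
    rw [hC, Matrix.rank_conjTranspose_mul_self, Matrix.rank_eq_finrank_span_cols]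
    have : S = (Submodule.span ℂ (Set.range C.col)).map
        (WithLp.linearEquiv 2 ℂ (Fin k → ℂ)).symm.toLinearMap := by
      rw [Submodule.map_span, ← Set.range_comp]; rfl
    rw [this]
    exact LinearEquiv.finrank_map_eq _ _
  let e := ((stdOrthonormalBasis ℂ S).reindex (finCongr hfr)).repr
  let w : I → S := fun m => ⟨u m, Submodule.subset_span ⟨m, rfl⟩⟩
  refine ⟨fun m => e (w m), fun m n => ?_, ?_⟩
  · rw [e.inner_map_map]; exact huT m n
  · have hw : Submodule.span ℂ (Set.range w) = ⊤ := by
      have h := Submodule.span_span_coe_preimage (R := ℂ) (s := Set.range u)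
      convert h using 2
      ext x
      simp [w, Subtype.ext_iff]
    have : Set.range (fun m => e (w m)) = e.toLinearEquiv.toLinearMap '' Set.range w := by
      rw [← Set.range_comp]; rfl
    rw [this, ← Submodule.map_span, hw, Submodule.map_top]
    exact LinearEquiv.range _

section Shift

variable {d : ℕ} {N : Fin d → ℕ} {V : (Fin d → ℕ) → E}

/-- The span of a family generated by shift operators does not change when the last index is
dropped in the directions of `S`. -/
theorem span_shift_restrict [FiniteDimensional ℂ E] (U : Fin d → Module.End ℂ E)
    (hU : ∀ i m, (∀ j, m j < N j) → m i + 1 < N i → U i (V m) = V (m + Pi.single i 1))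
    (hspan : Submodule.span ℂ (V '' {m | ∀ i, m i < N i}) = ⊤)
    (hr : ∀ i, Module.finrank ℂ E < N i) (S : Finset (Fin d)) :
    Submodule.span ℂ (V '' {m | (∀ i, m i < N i) ∧ ∀ i ∈ S, m i + 1 < N i}) = ⊤ := by
  induction S using Finset.induction_on with
  | empty => simpa using hspan
  | insert i S hi ih =>
    rw [eq_top_iff, ← ih, Submodule.span_le]
    rintro _ ⟨m, ⟨hm, hmS⟩, rfl⟩
    rcases (Nat.succ_le_of_lt (hm i)).lt_or_eq with hlt | heq
    · refine Submodule.subset_span ⟨m, ⟨hm, fun j hj => ?_⟩, rfl⟩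
      rcases Finset.mem_insert.1 hj with rfl | hj
      exacts [hlt, hmS j hj]
    have hbox : ∀ k, k < N i → ∀ j, Function.update m i k j < N j := fun k hk j => by
      rcases eq_or_ne j i with rfl | hj
      · simpa using hk
      · simpa [hj] using hm j
    have hpow : ∀ k, k < N i →
        (U i ^ k) (V (Function.update m i 0)) = V (Function.update m i k) := by
      intro k
      induction k with
      | zero => intro _; simp
      | succ k ihk =>
        intro hk
        rw [pow_succ', Module.End.mul_apply, ihk (by omega),
          hU i _ (hbox k (by omega)) (by simpa using hk)]
        congr 1
        ext j
        rcases eq_or_ne j i with rfl | hj <;> simp [*]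
    have hmem := pow_apply_mem_span_of_finrank_le (U i) (V (Function.update m i 0))
      (n := m i) (by have := hr i; omega)
    rw [hpow _ (hm i), Function.update_eq_self] at hmem
    refine Submodule.span_mono ?_ hmem
    rintro _ ⟨k, hk, rfl⟩
    have hkN := hk.trans (hm i)
    refine ⟨Function.update m i k, ⟨hbox k hkN, fun j hj => ?_⟩, (hpow k hkN).symm⟩
    rcases Finset.mem_insert.1 hj with rfl | hj
    · simp; omega
    · have : j ≠ i := fun h => hi (h ▸ hj)
      simpa [this] using hmS j hj

/-- A family of vectors on a box whose Gram matrix is multilevel Toeplitz of small rank is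
simultaneously generated by commuting unitaries, hence geometric in some orthonormal basis. -/
theorem exists_orthonormalBasis_of_toeplitz_gram [FiniteDimensional ℂ E] (C : (Fin d → ℤ) → ℂ)
    (hG : ∀ m n : Fin d → ℕ, (∀ i, m i < N i) → (∀ i, n i < N i) →
      inner ℂ (V m) (V n) = C fun i => (m i : ℤ) - n i)
    (hspan : Submodule.span ℂ (V '' {m | ∀ i, m i < N i}) = ⊤)
    (hr : ∀ i, Module.finrank ℂ E < N i) {r : ℕ} (hn : Module.finrank ℂ E = r) :
    Submodule.span ℂ (V '' {m | ∀ i, m i + 1 < N i}) = ⊤ ∧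
    ∃ (b : OrthonormalBasis (Fin r) ℂ E) (z : Fin r → Fin d → ℂ),
      (∀ l i, ‖z l i‖ = 1) ∧ ∀ l i m, (∀ j, m j < N j) → m i + 1 < N i →
        inner ℂ (b l) (V (m + Pi.single i 1)) = z l i * inner ℂ (b l) (V m) := by
  have hsh : ∀ i (m : Fin d → ℕ), (∀ j, m j < N j) → m i + 1 < N i →
      ∀ j, (m + Pi.single i 1 : Fin d → ℕ) j < N j := by
    intro i m hm hi j
    rcases eq_or_ne j i with rfl | hj
    · simpa using hi
    · simpa [hj] using hm j
  have hex : ∀ i, ∃ U : E →ₗᵢ[ℂ] E, ∀ a : {m : Fin d → ℕ // (∀ j, m j < N j) ∧ m i + 1 < N i},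
      U (V a.1) = V (a.1 + Pi.single i 1) := fun i => by
    refine exists_linearIsometry_of_inner_eq
      (fun a : {m : Fin d → ℕ // (∀ j, m j < N j) ∧ m i + 1 < N i} => V a.1)
      (fun a => V (a.1 + Pi.single i 1)) ?_
    rintro ⟨m, hm, hmi⟩ ⟨n, hn, hni⟩
    simp only
    rw [hG m n hm hn, hG _ _ (hsh i m hm hmi) (hsh i n hn hni)]
    congr 1
    ext j
    simp
  choose U hU using hex
  have hU' : ∀ i m, (∀ j, m j < N j) → m i + 1 < N i → U i (V m) = V (m + Pi.single i 1) :=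
    fun i m hm hi => hU i ⟨m, hm, hi⟩
  have hS := span_shift_restrict (fun i => (U i).toLinearMap) hU' hspan hr
  have hcomm : ∀ i j x, U i (U j x) = U j (U i x) := by
    intro i j
    rcases eq_or_ne i j with rfl | hij
    · exact fun _ => rfl
    suffices (U i).toLinearMap ∘ₗ (U j).toLinearMap = (U j).toLinearMap ∘ₗ (U i).toLinearMap from
      fun x => LinearMap.congr_fun this x
    refine LinearMap.ext_on (hS {i, j}) ?_
    rintro _ ⟨m, ⟨hm, hmS⟩, rfl⟩
    have hi := hmS i (by simp)
    have hj := hmS j (by simp)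
    change U i (U j (V m)) = U j (U i (V m))
    rw [hU' j m hm hj, hU' i m hm hi, hU' i _ (hsh j m hm hj) (by simpa [hij] using hi),
      hU' j _ (hsh i m hm hi) (by simpa [hij.symm] using hj), add_right_comm]
  obtain ⟨b, z, hz⟩ := exists_orthonormalBasis_joint_eigenvector U hcomm hn
  have hz1 : ∀ l i, ‖z l i‖ = 1 := fun l i =>
    LinearIsometry.norm_eq_one_of_apply_eq_smul (b.orthonormal.ne_zero l) (hz l i)
  refine ⟨?_, b, z, hz1, fun l i m hm hi => ?_⟩
  · rw [eq_top_iff, ← hS Finset.univ]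
    refine Submodule.span_mono (Set.image_mono fun m hm i => hm.2 i (Finset.mem_univ i))
  · rw [← hU' i m hm hi, ← b.sum_repr (V m), map_sum, inner_sum, inner_sum, Finset.mul_sum]
    refine Finset.sum_congr rfl fun k _ => ?_
    rw [map_smul, hz, inner_smul_right, inner_smul_right, inner_smul_right,
      orthonormal_iff_ite.1 b.orthonormal]
    split_ifs with h
    · subst h; ring
    · simp

/-- Coordinates multiplied by `z i` under each shift are geometric. -/
theorem eq_mul_prod_pow_of_shift {φ : (Fin d → ℕ) → ℂ} {z : Fin d → ℂ}
    (h : ∀ i m, (∀ j, m j < N j) → m i + 1 < N i → φ (m + Pi.single i 1) = z i * φ m)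
    (m : Fin d → ℕ) (hm : ∀ j, m j < N j) : φ m = φ 0 * ∏ i, z i ^ m i := by
  induction hk : ∑ i, m i generalizing m with
  | zero =>
    have : m = 0 := by ext i; simpa using (Finset.sum_eq_zero_iff.1 hk) i
    simp [this]
  | succ k ih =>
    obtain ⟨i, hi⟩ : ∃ i, 0 < m i := by
      by_contra! h0
      simp [fun i => Nat.le_zero.1 (h0 i)] at hk
    set m' := Function.update m i (m i - 1) with hm'
    have hmm : m = m' + Pi.single i 1 := by
      ext j
      rcases eq_or_ne j i with rfl | hj
      · simp [hm']; omega
      · simp [hm', hj]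
    have hle : ∀ j, m' j ≤ m j := fun j => by rw [hmm]; simp
    have hbox : ∀ j, m' j < N j := fun j => (hle j).trans_lt (hm j)
    have hi' : m' i + 1 < N i := by have := hm i; simp [hm']; omega
    have hsum : ∑ j, m' j = k := by
      rw [hmm] at hk
      simpa [Finset.sum_add_distrib] using hk
    have hprod : ∏ j, z j ^ m j = z i * ∏ j, z j ^ m' j := by
      rw [hmm]
      simp only [Pi.add_apply, pow_add]
      rw [Finset.prod_mul_distrib, mul_comm]
      congr 1
      simp [Pi.single_apply]
    rw [hprod, mul_left_comm, ← ih m' hbox hsum, ← h i m' hbox hi', ← hmm]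

end Shift


/-- If a diagonal form written in a spanning family is positive semidefinite, its coefficients are
nonnegative. -/
theorem nonneg_of_posSemidef_diagonal {I L : Type*} [Fintype I] [Fintype L] {M : Matrix I I ℂ}
    (hM : M.PosSemidef) (b : OrthonormalBasis L ℂ E) (g : L → ℂ) (v : I → E)
    (hv : Submodule.span ℂ (Set.range v) = ⊤)
    (h : ∀ m n, M m n = ∑ l, g l * (inner ℂ (v m) (b l) * inner ℂ (b l) (v n))) (l : L) :
    0 ≤ g l := by
  classical
  obtain ⟨x, hx⟩ := (Submodule.mem_span_range_iff_exists_fun ℂ).1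
    (hv ▸ Submodule.mem_top : b l ∈ Submodule.span ℂ (Set.range v))
  have key : star x ⬝ᵥ (M *ᵥ x) =
      ∑ k, g k * (inner ℂ (∑ m, x m • v m) (b k) * inner ℂ (b k) (∑ n, x n • v n)) := by
    simp only [dotProduct, Matrix.mulVec, h, sum_inner, inner_sum, inner_smul_left,
      inner_smul_right, Finset.sum_mul, Finset.mul_sum, Pi.star_apply]
    rw [Finset.sum_congr rfl fun m _ => Finset.sum_comm, Finset.sum_comm]
    refine Finset.sum_congr rfl fun k _ => ?_
    rw [Finset.sum_comm]
    refine Finset.sum_congr rfl fun m _ => Finset.sum_congr rfl fun n _ => ?_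
    simp only [Complex.star_def]
    ring
  have h0 := hM.dotProduct_mulVec_nonneg x
  rw [key, hx] at h0
  simpa [orthonormal_iff_ite.1 b.orthonormal] using h0

/-- Coordinates of a spanning family in an orthonormal basis do not vanish identically. -/
theorem exists_inner_ne_zero_of_span_eq_top {s : Set E} (hs : Submodule.span ℂ s = ⊤) {w : E}
    (hw : w ≠ 0) : ∃ x ∈ s, inner ℂ w x ≠ 0 := by
  by_contra! h
  refine hw (inner_self_eq_zero (𝕜 := ℂ).1 ?_)
  have : (⊤ : Submodule ℂ E) ≤ (innerSL ℂ w).toLinearMap.ker := by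
    rw [← hs, Submodule.span_le]
    exact fun x hx => h x hx
  exact this Submodule.mem_top

end

/-- Every complex number of modulus one is `exp (2πit)` for some `t ∈ [0, 1)`. -/
theorem exists_exp_two_pi_eq {w : ℂ} (hw : ‖w‖ = 1) :
    ∃ t : ℝ, 0 ≤ t ∧ t < 1 ∧ Complex.exp (2 * (Real.pi : ℂ) * Complex.I * (t : ℂ)) = w := by
  have hpi : (Real.pi : ℂ) ≠ 0 := by exact_mod_cast Real.pi_ne_zero
  refine ⟨Int.fract (w.arg / (2 * Real.pi)), Int.fract_nonneg _, Int.fract_lt_one _, ?_⟩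
  have h1 : 2 * (Real.pi : ℂ) * Complex.I * ((Int.fract (w.arg / (2 * Real.pi)) : ℝ) : ℂ) =
      w.arg * Complex.I - (⌊w.arg / (2 * Real.pi)⌋ : ℂ) * (2 * Real.pi * Complex.I) := by
    rw [Int.fract]
    push_cast
    field_simp
  rw [h1, Complex.exp_sub, Complex.exp_int_mul_two_pi_mul_I, div_one]
  have := Complex.norm_mul_exp_arg_mul_I w
  rwa [hw, Complex.ofReal_one, one_mul] at this

/-- The band-pass trigonometric polynomial is nonnegative only on its band. -/
theorem mem_Icc_of_filter_nonneg {a b t : ℝ} (ha : 0 ≤ a) (hab : a < b) (hb : b < 1) (ht0 : 0 ≤ t)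
    (ht1 : t < 1) {w r1 : ℂ} (hw : Complex.exp (2 * (Real.pi : ℂ) * Complex.I * (t : ℂ)) = w)
    (hr1 : r1 = Complex.exp ((Real.pi : ℂ) * Complex.I * ((a : ℂ) + (b : ℂ))))
    (h : 0 ≤ (starRingEnd ℂ) r1 * w + ((-2 * Real.cos (Real.pi * (b - a)) : ℝ) : ℂ) +
      r1 * (starRingEnd ℂ) w) : t ∈ Set.Icc a b := by
  have hpi := Real.pi_pos
  have hsum : (starRingEnd ℂ) r1 * w + r1 * (starRingEnd ℂ) w =
      ((2 * Real.cos (Real.pi * (2 * t - a - b)) : ℝ) : ℂ) := by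
    rw [hr1, ← hw, ← Complex.exp_conj, ← Complex.exp_conj, ← Complex.exp_add, ← Complex.exp_add]
    push_cast
    rw [Complex.two_cos]
    simp only [map_mul, map_add, Complex.conj_I, Complex.conj_ofReal, map_ofNat]
    congr 1 <;> ring_nf
  rw [add_right_comm, hsum, ← Complex.ofReal_add, Complex.zero_le_real] at h
  have hcos : Real.cos (Real.pi * (b - a)) ≤ Real.cos (Real.pi * (2 * t - a - b)) := by linarith
  have hle : ∀ x, 0 ≤ x → x ≤ Real.pi →
      Real.cos (Real.pi * (b - a)) ≤ Real.cos x → x ≤ Real.pi * (b - a) := fun x h0 h1 hx =>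
    (Real.strictAntiOn_cos.le_iff_ge ⟨by nlinarith, by nlinarith⟩ ⟨h0, h1⟩).1 hx
  have habs : ∀ s, -2 < s → s < 2 →
      Real.cos (Real.pi * (b - a)) ≤ Real.cos (Real.pi * s) →
      (-(b - a) ≤ s ∧ s ≤ b - a) ∨ 2 - (b - a) ≤ s ∨ s ≤ -2 + (b - a) := by
    intro s h1 h2 hs
    rcases le_or_gt s (-1) with h3 | h3
    · have := hle (Real.pi * (s + 2)) (by nlinarith) (by nlinarith) (by
        rw [mul_add, mul_comm Real.pi 2, Real.cos_add_two_pi]; exact hs)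
      have := le_of_mul_le_mul_left this hpi
      right; right; linarith
    rcases le_or_gt s 0 with h4 | h4
    · have := hle (Real.pi * -s) (by nlinarith) (by nlinarith) (by
        rw [mul_neg, Real.cos_neg]; exact hs)
      have := le_of_mul_le_mul_left this hpi
      left; constructor <;> linarith
    rcases le_or_gt s 1 with h5 | h5
    · have := hle (Real.pi * s) (by nlinarith) (by nlinarith) hs
      have := le_of_mul_le_mul_left this hpi
      left; constructor <;> linarith
    · have := hle (Real.pi * (2 - s)) (by nlinarith) (by nlinarith) (by
        rw [mul_sub Real.pi 2 s, mul_comm Real.pi 2, Real.cos_two_pi_sub]; exact hs)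
      have := le_of_mul_le_mul_left this hpi
      right; left; linarith
  rcases habs (2 * t - a - b) (by linarith) (by linarith) hcos with h | h | h
  · constructor <;> linarith
  · linarith
  · linarith

/-- Frequency-selective MD Vandermonde decomposition: if `T(B)` is PSD with rank
`r < min_i N_i` and all filtered matrices `T_{g_i}(B)` are PSD, then
`T(B) = ∑ ℓ σ_ℓ a(f_ℓ) a(f_ℓ)ᴴ` with distinct `f_ℓ`, `f_{i,ℓ} ∈ [f_{L,i}, f_{H,i}]`
and `σ_ℓ > 0`. -/
theorem stmt6 {d : ℕ} (hd : 1 ≤ d) (N : Fin d → ℕ) (hN : ∀ i, 2 ≤ N i)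
    (fL fH : Fin d → ℝ) (hL0 : ∀ i, 0 ≤ fL i) (hLH : ∀ i, fL i < fH i)
    (hH1 : ∀ i, fH i < 1)
    (B : (Fin d → ℤ) → ℂ)
    (hpsd : (toepT N B).PosSemidef)
    (hrank : ∀ i, (toepT N B).rank < N i)
    (hTg : ∀ i, (toepTg N i (-2 * Real.cos (Real.pi * (fH i - fL i)))
        (Complex.exp ((Real.pi : ℂ) * Complex.I * ((fL i : ℂ) + (fH i : ℂ)))) B).PosSemidef) :
    ∃ (f : Fin (toepT N B).rank → (Fin d → ℝ)) (σ : Fin (toepT N B).rank → ℝ),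
      Function.Injective f ∧
      (∀ ℓ i, f ℓ i ∈ Set.Icc (fL i) (fH i)) ∧
      (∀ ℓ, 0 < σ ℓ) ∧
      toepT N B = ∑ ℓ, (σ ℓ : ℂ) •
        Matrix.vecMulVec (sinusoid N (f ℓ)) (star (sinusoid N (f ℓ))) := by
  classical
  obtain ⟨v, hv, hvspan⟩ := hpsd.exists_gram
  have hfin : Module.finrank ℂ (EuclideanSpace ℂ (Fin (toepT N B).rank)) = (toepT N B).rank := by
    simp
  set V : (Fin d → ℕ) → EuclideanSpace ℂ (Fin (toepT N B).rank) := fun m =>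
    if h : ∀ i, m i < N i then v fun i => ⟨m i, h i⟩ else 0 with hVdef
  have hV : ∀ m : ∀ i, Fin (N i), V (fun i => m i) = v m := fun m => by simp [hVdef]
  have hG : ∀ m n : Fin d → ℕ, (∀ i, m i < N i) → (∀ i, n i < N i) →
      inner ℂ (V m) (V n) = B fun i => (m i : ℤ) - n i := fun m n hm hn => by
    have := hv (fun i => ⟨m i, hm i⟩) (fun i => ⟨n i, hn i⟩)
    rwa [← hV, ← hV] at this
  have himg : V '' {m | ∀ i, m i < N i} = Set.range v := by
    ext x
    constructor
    · rintro ⟨m, hm, rfl⟩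
      exact ⟨fun i => ⟨m i, hm i⟩, (hV _).symm⟩
    · rintro ⟨m, rfl⟩
      exact ⟨fun i => m i, fun i => (m i).2, hV m⟩
  obtain ⟨hinner, b, z, hz, hstep⟩ := exists_orthonormalBasis_of_toeplitz_gram B hG
    (himg ▸ hvspan) (fun i => hfin.symm ▸ hrank i) hfin
  have hgeo : ∀ l (m : Fin d → ℕ), (∀ j, m j < N j) →
      inner ℂ (b l) (V m) = inner ℂ (b l) (V 0) * ∏ i, z l i ^ m i := fun l =>
    eq_mul_prod_pow_of_shift fun i m => hstep l i m
  have hgeo' : ∀ l (m : ∀ i, Fin (N i)),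
      inner ℂ (b l) (v m) = inner ℂ (b l) (V 0) * ∏ i, z l i ^ (m i : ℕ) := fun l m => by
    rw [← hV, hgeo l _ fun i => (m i).2]
  choose f hf0 hf1 hf using fun l i =>
    exists_exp_two_pi_eq (w := (starRingEnd ℂ) (z l i)) (by rw [RCLike.norm_conj, hz])
  have hsin : ∀ l m, sinusoid N (f l) m = (starRingEnd ℂ) (∏ i, z l i ^ (m i : ℕ)) := fun l m => by
    simp only [sinusoid, map_prod, map_pow, ← hf, ← Complex.exp_nat_mul]
    exact Finset.prod_congr rfl fun i _ => by ring_nf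
  have hc : ∀ l, inner ℂ (b l) (V 0) ≠ 0 := fun l h0 => by
    obtain ⟨_, ⟨m, rfl⟩, hm⟩ :=
      exists_inner_ne_zero_of_span_eq_top hvspan (b.orthonormal.ne_zero l)
    exact hm (by rw [hgeo', h0, zero_mul])
  refine ⟨f, fun l => ‖inner ℂ (b l) (V 0)‖ ^ 2, ?_, ?_,
    fun l => pow_pos (norm_pos_iff.2 (hc l)) 2, ?_⟩
  · intro l k hlk
    by_contra hne
    have hzlk : z l = z k := by
      ext i
      exact (starRingEnd ℂ).injective (by rw [← hf, ← hf, hlk])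
    set w := (starRingEnd ℂ) (inner ℂ (b k) (V 0)) • b l -
      (starRingEnd ℂ) (inner ℂ (b l) (V 0)) • b k with hw
    have hw0 : w ≠ 0 := fun h0 => by
      have : inner ℂ (b l) w = (starRingEnd ℂ) (inner ℂ (b k) (V 0)) := by
        rw [hw, inner_sub_right, inner_smul_right, inner_smul_right,
          orthonormal_iff_ite.1 b.orthonormal, orthonormal_iff_ite.1 b.orthonormal]
        simp [hne]
      rw [h0, inner_zero_right] at this
      exact hc k ((map_eq_zero _).1 this.symm)
    obtain ⟨_, ⟨m, rfl⟩, hm⟩ := exists_inner_ne_zero_of_span_eq_top hvspan hw0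
    refine hm ?_
    rw [hw, inner_sub_left, inner_smul_left, inner_smul_left, hgeo', hgeo', hzlk, Complex.conj_conj,
      Complex.conj_conj]
    ring
  · intro l i
    set r1 := Complex.exp ((Real.pi : ℂ) * Complex.I * ((fL i : ℂ) + (fH i : ℂ))) with hr1
    set r0 := -2 * Real.cos (Real.pi * (fH i - fL i)) with hr0
    refine mem_Icc_of_filter_nonneg (hL0 i) (hLH i) (hH1 i) (hf0 l i) (hf1 l i) (hf l i) hr1 ?_
    rw [Complex.conj_conj]
    refine nonneg_of_posSemidef_diagonal (hTg i) b
      (fun k => (starRingEnd ℂ) r1 * (starRingEnd ℂ) (z k i) + (r0 : ℂ) + r1 * z k i)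
      (fun m => V fun j => m j) ?_ (fun m n => ?_) l
    · rw [← hinner]
      congr 1
      ext x
      constructor
      · rintro ⟨m, rfl⟩
        exact ⟨_, fun j => by have := (m j).2; omega, rfl⟩
      · rintro ⟨m, hm, rfl⟩
        exact ⟨fun j => ⟨m j, by have := hm j; omega⟩, rfl⟩
    · set m' : Fin d → ℕ := fun j => m j with hm'
      set n' : Fin d → ℕ := fun j => n j with hn'
      have hm : ∀ j, m' j + 1 < N j := fun j => by have := (m j).2; simp only [hm']; omega
      have hn : ∀ j, n' j + 1 < N j := fun j => by have := (n j).2; simp only [hn']; omega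
      have hm0 : ∀ j, m' j < N j := fun j => by have := hm j; omega
      have hn0 : ∀ j, n' j < N j := fun j => by have := hn j; omega
      have hs : ∀ p : Fin d → ℕ, (∀ j, p j + 1 < N j) →
          ∀ j, (p + Pi.single i 1 : Fin d → ℕ) j < N j := fun p hp j => by
        have := hp j
        rcases eq_or_ne j i with rfl | hj
        · simpa using this
        · simp [hj]; omega
      have h1 := hG _ _ (hs m' hm) hn0
      have h2 := hG _ _ hm0 hn0
      have h3 := hG _ _ hm0 (hs n' hn)
      have e1 : (fun j => (m j : ℤ) - (n j : ℤ) + (if j = i then 1 else 0)) =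
          fun j => (((m' + Pi.single i 1 : Fin d → ℕ) j : ℕ) : ℤ) - (n' j : ℤ) := by
        ext j
        rcases eq_or_ne j i with rfl | hj
        · simp [hm', hn']; ring
        · simp [hm', hn', hj]
      have e3 : (fun j => (m j : ℤ) - (n j : ℤ) - (if j = i then 1 else 0)) =
          fun j => (m' j : ℤ) - (((n' + Pi.single i 1 : Fin d → ℕ) j : ℕ) : ℤ) := by
        ext j
        rcases eq_or_ne j i with rfl | hj
        · simp [hm', hn']; ring
        · simp [hm', hn', hj]
      simp only [toepTg, Matrix.of_apply]
      rw [e1, e3, ← h1, ← h2, ← h3, ← b.sum_inner_mul_inner, ← b.sum_inner_mul_inner (V m') (V n'),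
        ← b.sum_inner_mul_inner (V m'), Finset.mul_sum, Finset.mul_sum, Finset.mul_sum,
        ← Finset.sum_add_distrib, ← Finset.sum_add_distrib]
      refine Finset.sum_congr rfl fun k _ => ?_
      rw [hstep k i n' hn0 (hn i), ← inner_conj_symm (V (m' + Pi.single i 1)) (b k),
        hstep k i m' hm0 (hm i), map_mul, inner_conj_symm]
      ring
  · ext m n
    rw [← hv, ← b.sum_inner_mul_inner, Matrix.sum_apply]
    refine Finset.sum_congr rfl fun l _ => ?_
    rw [← inner_conj_symm (v m) (b l), hgeo', hgeo', Matrix.smul_apply, Matrix.vecMulVec_apply,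
      Pi.star_apply, hsin, hsin, smul_eq_mul, Complex.star_def, Complex.conj_conj, map_mul]
    push_cast
    rw [← Complex.conj_mul']
    ring
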